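/- Let n ≥ 1 and m ≥ 1 be integers and let M₁, …, M_m ∈ ℝ^{n×n} be matrices, each with zero diagonal, satisfying ⟨M_i, M_i⟩ = 1 for all i and ⟨M_i, M_j⟩ = 0 for all i ≠ j, where ⟨A,B⟩ = Σ_{i,j} A_{ij} B_{ij}. For x ∈ ℝ^n let ⟨x⊗̇x, M⟩ = Σ_{i≠j} x_i x_j M_{ij}. Then for every real r ≥ 98m, γ_n({x ∈ ℝ^n : Σ_{i=1}^m ⟨x⊗̇x, M_i⟩² ≥ r}) ≤ exp(−r/(56448·(m+√r))). -/

import Mathlib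

open MeasureTheory ProbabilityTheory Finset Real

noncomputable section

/-- Standard Gaussian probability measure on `ℝ^n`. -/
def gaussianPi (n : ℕ) : Measure (Fin n → ℝ) :=
  Measure.pi fun _ => gaussianReal 0 1

/-- `⟨x ⊗̇ x, M⟩ = ∑_{i≠j} xᵢxⱼ M_{ij}` : the quadratic form associated to the
off-diagonal tensor of `x`. -/
def offDiagForm {n : ℕ} (x : Fin n → ℝ) (M : Matrix (Fin n) (Fin n) ℝ) : ℝ :=
  ∑ a : Fin n, ∑ b : Fin n, if a ≠ b then x a * x b * M a b else 0

lemma exp_neg_sub_sq_le_one_sub {z : ℝ} (hz : |z| ≤ 1 / 2) : exp (-z - z ^ 2) ≤ 1 - z := by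
  have h := abs_le.1 hz
  have h1 : 1 ≤ (1 - z) * exp (z + z ^ 2) := by
    rcases le_total 0 z with h0 | h0
    · have h2 := Real.quadratic_le_exp_of_nonneg (x := z + z ^ 2) (by positivity)
      have h3 : z ≤ (1 - z) * (1 + z) ^ 2 / 2 := by
        nlinarith [mul_nonneg h0 (sub_nonneg.2 h.2), mul_nonneg (sq_nonneg z) (sub_nonneg.2 h.2)]
      nlinarith [mul_le_mul_of_nonneg_left h2 (by linarith : 0 ≤ 1 - z),
        mul_le_mul_of_nonneg_left h3 (sq_nonneg z)]
    · nlinarith [mul_le_mul_of_nonneg_left (Real.add_one_le_exp (z + z ^ 2))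
        (by linarith : 0 ≤ 1 - z), mul_nonneg (sq_nonneg z) (neg_nonneg.2 h0)]
  have h2 : exp (-z - z ^ 2) * exp (z + z ^ 2) = 1 := by
    rw [← Real.exp_add, ← Real.exp_zero]; ring_nf
  exact le_of_mul_le_mul_right (h2.trans_le h1) (exp_pos _)

lemma integrable_exp_mul_sq_gaussianReal {c : ℝ} (hc : c < 1 / 2) :
    Integrable (fun x => exp (c * x ^ 2)) (gaussianReal 0 1) := by
  rw [gaussianReal_of_var_ne_zero _ one_ne_zero, integrable_withDensity_iff_integrable_smul₀'
    (by fun_prop) (by simp [gaussianPDF])]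
  have := (integrable_exp_neg_mul_sq (b := 1/2 - c) (by linarith)).const_mul (√(2 * π))⁻¹
  refine this.congr (ae_of_all _ fun x => ?_)
  simp only [toReal_gaussianPDF, gaussianPDFReal, smul_eq_mul, NNReal.coe_one, mul_assoc,
    ← Real.exp_add]
  ring_nf

lemma integral_exp_mul_sq_gaussianReal_le {c : ℝ} (hc : |c| ≤ 1 / 4) :
    ∫ x, exp (c * x ^ 2) ∂(gaussianReal 0 1) ≤ exp (c + 2 * c ^ 2) := by
  have hc' := abs_le.1 hc
  have h1 : ∫ x, exp (c * x ^ 2) ∂(gaussianReal 0 1) = √(1 - 2 * c)⁻¹ := by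
    rw [integral_gaussianReal_eq_integral_smul one_ne_zero]
    have : ∀ x : ℝ, gaussianPDFReal 0 1 x • exp (c * x ^ 2)
        = (√(2 * π))⁻¹ * exp (-(1 / 2 - c) * x ^ 2) := by
      intro x
      simp only [gaussianPDFReal, smul_eq_mul, NNReal.coe_one, mul_assoc, ← Real.exp_add]
      ring_nf
    simp_rw [this]
    rw [integral_const_mul, integral_gaussian, ← Real.sqrt_inv, ← Real.sqrt_mul (by positivity)]
    congr 1
    have : 1 / 2 - c ≠ 0 := by linarith
    have : 1 - 2 * c ≠ 0 := by linarith
    field_simp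
  rw [h1]
  apply Real.sqrt_le_iff.2 ⟨by positivity, ?_⟩
  have h2 := exp_neg_sub_sq_le_one_sub (z := 2 * c) (by rw [abs_le]; constructor <;> linarith)
  have h3 : (1 - 2 * c)⁻¹ ≤ (exp (-(2 * c) - (2 * c) ^ 2))⁻¹ := by gcongr
  rw [← Real.exp_neg] at h3
  rw [← Real.exp_nat_mul]
  refine h3.trans (le_of_eq ?_)
  congr 1; push_cast; ring

lemma sum_sq_eigenvalues {n : ℕ} {S : Matrix (Fin n) (Fin n) ℝ} (hS : S.IsHermitian) :
    ∑ i, hS.eigenvalues i ^ 2 = ∑ a, ∑ b, S a b ^ 2 := by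
  have h1 : (S * S).trace = ∑ i, hS.eigenvalues i ^ 2 := by
    conv_lhs => rw [hS.spectral_theorem, ← map_mul]
    rw [Unitary.conjStarAlgAut_apply, Matrix.trace_mul_cycle]
    simp [pow_two]
  rw [← h1, Matrix.trace]
  simp only [Matrix.diag_apply, Matrix.mul_apply, pow_two]
  refine sum_congr rfl fun a _ => sum_congr rfl fun b _ => ?_
  rw [← hS.apply b a]; simp

lemma quadForm_sum_eigenvectorBasis {n : ℕ} {S : Matrix (Fin n) (Fin n) ℝ} (hS : S.IsHermitian)
    (x : Fin n → ℝ) :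
    (∑ i, x i • hS.eigenvectorBasis i).ofLp ⬝ᵥ S.mulVec (∑ i, x i • hS.eigenvectorBasis i).ofLp
      = ∑ i, hS.eigenvalues i * x i ^ 2 := by
  have h0 : (∑ i, x i • hS.eigenvectorBasis i).ofLp = ∑ i, x i • (hS.eigenvectorBasis i).ofLp := by
    simp
  have h1 : S.mulVec (∑ i, x i • hS.eigenvectorBasis i).ofLp
      = (∑ i, (hS.eigenvalues i * x i) • hS.eigenvectorBasis i).ofLp := by
    rw [h0, Matrix.mulVec_sum]
    simp [Matrix.mulVec_smul, hS.mulVec_eigenvectorBasis, smul_smul, mul_comm]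
  have h2 : ∀ u v : EuclideanSpace ℝ (Fin n), u.ofLp ⬝ᵥ v.ofLp = inner ℝ u v := by
    intro u v; simp [PiLp.inner_apply, dotProduct, mul_comm]
  rw [h1, h2, hS.eigenvectorBasis.orthonormal.inner_sum]
  refine sum_congr rfl fun i _ => ?_
  simp only [conj_trivial]
  ring

lemma exp_quadForm_gaussianPi {n : ℕ} {S : Matrix (Fin n) (Fin n) ℝ} (hS : S.IsHermitian)
    (htr : S.trace = 0) (hbd : ∑ a, ∑ b, S a b ^ 2 ≤ 1 / 16) :
    Integrable (fun x => exp (x ⬝ᵥ S.mulVec x)) (gaussianPi n) ∧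
      ∫ x, exp (x ⬝ᵥ S.mulVec x) ∂(gaussianPi n) ≤ exp (2 * ∑ a, ∑ b, S a b ^ 2) := by
  have hev : ∀ i, |hS.eigenvalues i| ≤ 1 / 4 := by
    intro i
    apply abs_le_of_sq_le_sq _ (by norm_num)
    rw [← sum_sq_eigenvalues hS] at hbd
    have := single_le_sum (f := fun i => hS.eigenvalues i ^ 2) (fun j _ => sq_nonneg _) (mem_univ i)
    linarith
  have hmap : (gaussianPi n).map (WithLp.toLp 2)
      = (gaussianPi n).map (fun x => ∑ i, x i • hS.eigenvectorBasis i) := by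
    rw [gaussianPi, map_pi_eq_stdGaussian,
      ← stdGaussian_eq_map_pi_orthonormalBasis hS.eigenvectorBasis]
  let f : EuclideanSpace ℝ (Fin n) → ℝ := fun y => exp (y.ofLp ⬝ᵥ S.mulVec y.ofLp)
  have hf : Continuous f := by
    simp only [f]
    fun_prop
  have hprod : ∀ x : Fin n → ℝ, f (∑ i, x i • hS.eigenvectorBasis i)
      = ∏ i, exp (hS.eigenvalues i * x i ^ 2) := by
    intro x
    simp only [f, quadForm_sum_eigenvectorBasis, Real.exp_sum]
  have hm1 : Measurable (WithLp.toLp 2 : (Fin n → ℝ) → EuclideanSpace ℝ (Fin n)) := by fun_prop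
  have hm2 : Measurable (fun x : Fin n → ℝ => ∑ i, x i • hS.eigenvectorBasis i) := by fun_prop
  have hlt : ∀ i, hS.eigenvalues i < 1 / 2 := fun i => by
    linarith [(abs_le.1 (hev i)).2]
  constructor
  · have h1 : Integrable f ((gaussianPi n).map (WithLp.toLp 2)) := by
      rw [hmap, integrable_map_measure hf.aestronglyMeasurable hm2.aemeasurable]
      refine Integrable.congr (f := fun x => ∏ i, exp (hS.eigenvalues i * x i ^ 2)) ?_
        (ae_of_all _ fun x => (hprod x).symm)
      exact Integrable.fintype_prod (f := fun i x => exp (hS.eigenvalues i * x ^ 2))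
        fun i => integrable_exp_mul_sq_gaussianReal (hlt i)
    rwa [integrable_map_measure hf.aestronglyMeasurable hm1.aemeasurable] at h1
  · calc ∫ x, exp (x ⬝ᵥ S.mulVec x) ∂(gaussianPi n)
        = ∫ y, f y ∂((gaussianPi n).map (WithLp.toLp 2)) := by
          rw [integral_map hm1.aemeasurable hf.aestronglyMeasurable]
      _ = ∫ x, ∏ i, exp (hS.eigenvalues i * x i ^ 2) ∂(gaussianPi n) := by
          rw [hmap, integral_map hm2.aemeasurable hf.aestronglyMeasurable]
          simp_rw [hprod]
      _ = ∏ i, ∫ x, exp (hS.eigenvalues i * x ^ 2) ∂(gaussianReal 0 1) :=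
          integral_fintype_prod_eq_prod (fun i x => exp (hS.eigenvalues i * x ^ 2))
      _ ≤ ∏ i, exp (hS.eigenvalues i + 2 * hS.eigenvalues i ^ 2) :=
          prod_le_prod (fun i _ => integral_nonneg fun x => (exp_pos _).le)
            fun i _ => integral_exp_mul_sq_gaussianReal_le (hev i)
      _ = exp (2 * ∑ a, ∑ b, S a b ^ 2) := by
          have h := hS.trace_eq_sum_eigenvalues
          rw [htr] at h
          simp at h
          rw [← Real.exp_sum, sum_add_distrib, ← h, ← mul_sum, sum_sq_eigenvalues, zero_add]

lemma offDiagForm_eq_quadForm_symm {n : ℕ} (x : Fin n → ℝ) {M : Matrix (Fin n) (Fin n) ℝ}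
    (hM : ∀ a, M a a = 0) :
    offDiagForm x M = x ⬝ᵥ ((1 / 2 : ℝ) • (M + M.transpose)).mulVec x := by
  have h1 : offDiagForm x M = ∑ a, ∑ b, x a * x b * M a b := by
    refine sum_congr rfl fun a _ => sum_congr rfl fun b _ => ?_
    split_ifs with h
    · rfl
    · simp [not_not.1 h, hM]
  have h2 : ∑ a, ∑ b, x a * x b * M a b = ∑ a, ∑ b, x a * x b * M b a := by
    rw [sum_comm]
    refine sum_congr rfl fun a _ => sum_congr rfl fun b _ => ?_
    ring
  have h3 : x ⬝ᵥ ((1 / 2 : ℝ) • (M + M.transpose)).mulVec x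
      = (1 / 2) * (∑ a, ∑ b, x a * x b * M a b + ∑ a, ∑ b, x a * x b * M b a) := by
    simp only [dotProduct, Matrix.mulVec, Matrix.smul_apply, Matrix.add_apply,
      Matrix.transpose_apply, mul_sum, ← sum_add_distrib, smul_eq_mul]
    refine sum_congr rfl fun a _ => sum_congr rfl fun b _ => ?_
    ring
  rw [h1, h3, ← h2]
  ring

lemma sum_sq_symm_le {n : ℕ} (M : Matrix (Fin n) (Fin n) ℝ) :
    ∑ a, ∑ b, ((1 / 2 : ℝ) • (M + M.transpose)) a b ^ 2 ≤ ∑ a, ∑ b, M a b ^ 2 := by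
  have h1 : ∑ a, ∑ b, M b a ^ 2 = ∑ a, ∑ b, M a b ^ 2 := sum_comm
  have h2 : ∑ a, ∑ b, M a b ^ 2 = ∑ a, ∑ b, (1 / 2) * (M a b ^ 2 + M b a ^ 2) := by
    simp only [← mul_sum, sum_add_distrib, h1]
    ring
  rw [h2]
  refine sum_le_sum fun a _ => sum_le_sum fun b _ => ?_
  simp only [Matrix.smul_apply, Matrix.add_apply, Matrix.transpose_apply, smul_eq_mul]
  nlinarith [sq_nonneg (M a b - M b a)]

lemma exp_offDiagForm_gaussianPi {n : ℕ} {M : Matrix (Fin n) (Fin n) ℝ}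
    (hM : ∀ a, M a a = 0) (hbd : ∑ a, ∑ b, M a b ^ 2 ≤ 1 / 16) :
    Integrable (fun x => exp (offDiagForm x M)) (gaussianPi n) ∧
      ∫ x, exp (offDiagForm x M) ∂(gaussianPi n) ≤ exp (1 / 8) := by
  have hle := (sum_sq_symm_le M).trans hbd
  have h := exp_quadForm_gaussianPi (S := (1 / 2 : ℝ) • (M + M.transpose))
    (by ext a b; simp; ring) (by simp [Matrix.trace, hM]) hle
  simp only [offDiagForm_eq_quadForm_symm _ hM]
  exact ⟨h.1, h.2.trans (Real.exp_le_exp.2 (by linarith))⟩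

lemma sum_sq_linear_combination {n m : ℕ} {M : Fin m → Matrix (Fin n) (Fin n) ℝ}
    (hunit : ∀ i, ∑ a : Fin n, ∑ b : Fin n, M i a b * M i a b = 1)
    (horth : ∀ i j, i ≠ j → ∑ a : Fin n, ∑ b : Fin n, M i a b * M j a b = 0) (w : Fin m → ℝ) :
    ∑ a, ∑ b, (∑ i, w i • M i) a b ^ 2 = ∑ i, w i ^ 2 := by
  have h : ∀ a b, (∑ i, w i • M i) a b ^ 2
      = ∑ i, ∑ j, w i * w j * (M i a b * M j a b) := by
    intro a b
    simp only [Matrix.sum_apply, Matrix.smul_apply, smul_eq_mul, pow_two, sum_mul_sum]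
    refine sum_congr rfl fun a _ => sum_congr rfl fun b _ => ?_
    ring
  have h2 : ∀ i j, ∑ a, ∑ b, M i a b * M j a b = if i = j then 1 else 0 := by
    intro i j
    split_ifs with hij
    · rw [← hij, hunit]
    · exact horth i j hij
  simp only [h]
  calc ∑ a, ∑ b, ∑ i, ∑ j, w i * w j * (M i a b * M j a b)
      = ∑ a, ∑ i, ∑ j, ∑ b, w i * w j * (M i a b * M j a b) := by
        refine sum_congr rfl fun a _ => ?_
        rw [sum_comm]
        exact sum_congr rfl fun i _ => sum_comm
    _ = ∑ i, ∑ j, ∑ a, ∑ b, w i * w j * (M i a b * M j a b) := by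
        rw [sum_comm]
        exact sum_congr rfl fun i _ => sum_comm
    _ = ∑ i, w i ^ 2 := by
        simp only [← mul_sum, h2]
        simp [pow_two]

lemma offDiagForm_linear_combination {n m : ℕ} (x : Fin n → ℝ)
    (M : Fin m → Matrix (Fin n) (Fin n) ℝ) (w : Fin m → ℝ) :
    offDiagForm x (∑ i, w i • M i) = ∑ i, w i * offDiagForm x (M i) := by
  simp only [offDiagForm, mul_sum]
  conv_rhs => rw [sum_comm]
  refine sum_congr rfl fun a _ => ?_
  conv_rhs => rw [sum_comm]
  refine sum_congr rfl fun b _ => ?_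
  split_ifs with h
  · simp only [Matrix.sum_apply, Matrix.smul_apply, smul_eq_mul, mul_sum]
    exact sum_congr rfl fun i _ => by ring
  · simp

lemma exp_sum_mul_offDiagForm_gaussianPi {n m : ℕ} {M : Fin m → Matrix (Fin n) (Fin n) ℝ}
    (hdiag : ∀ i a, M i a a = 0)
    (hunit : ∀ i, ∑ a : Fin n, ∑ b : Fin n, M i a b * M i a b = 1)
    (horth : ∀ i j, i ≠ j → ∑ a : Fin n, ∑ b : Fin n, M i a b * M j a b = 0)
    {w : Fin m → ℝ} (hw : ∑ i, w i ^ 2 ≤ 1 / 16) :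
    Integrable (fun x => exp (∑ i, w i * offDiagForm x (M i))) (gaussianPi n) ∧
      ∫ x, exp (∑ i, w i * offDiagForm x (M i)) ∂(gaussianPi n) ≤ exp (1 / 8) := by
  simp only [← offDiagForm_linear_combination]
  refine exp_offDiagForm_gaussianPi ?_ ?_
  · simp [Matrix.sum_apply, hdiag]
  · rwa [sum_sq_linear_combination hunit horth]

/-- Symmetrization: tilting an even weight by an exponential of a linear form increases its mass. -/
lemma lintegral_even_le_lintegral_mul_exp_inner {m : ℕ} {g : EuclideanSpace ℝ (Fin m) → ENNReal}
    (hg : Measurable g) (heven : ∀ w, g (-w) = g w) (y : EuclideanSpace ℝ (Fin m)) :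
    ∫⁻ w, g w ≤ ∫⁻ w, g w * ENNReal.ofReal (exp (inner ℝ w y)) := by
  set h : EuclideanSpace ℝ (Fin m) → ENNReal := fun w => g w * ENNReal.ofReal (exp (inner ℝ w y))
  have hh : Measurable h := by fun_prop
  have h1 : ∫⁻ w, h (-w) = ∫⁻ w, h w := lintegral_neg_eq_self h
  have h2 : 2 * ∫⁻ w, g w ≤ 2 * ∫⁻ w, h w := by
    calc 2 * ∫⁻ w, g w = ∫⁻ w, 2 * g w := (lintegral_const_mul _ hg).symm
      _ ≤ ∫⁻ w, (h w + h (-w)) := by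
          refine lintegral_mono fun w => ?_
          simp only [h, heven, inner_neg_left]
          rw [← mul_add, ← ENNReal.ofReal_add (exp_pos _).le (exp_pos _).le, mul_comm]
          gcongr
          refine (ENNReal.ofReal_ofNat 2).symm.trans_le (ENNReal.ofReal_le_ofReal ?_)
          linarith [Real.add_one_le_exp (inner ℝ w y), Real.add_one_le_exp (-(inner ℝ w y))]
      _ = 2 * ∫⁻ w, h w := by rw [lintegral_add_left hh, h1, two_mul]
  exact (ENNReal.mul_le_mul_iff_right two_ne_zero ENNReal.ofNat_ne_top).1 h2

/-- The Gaussian weight used to average over directions in `ℝ^m`. -/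
def gaussWeight (m : ℕ) (b : ℝ) (w : EuclideanSpace ℝ (Fin m)) : ENNReal :=
  ENNReal.ofReal (exp (-b * ‖w‖ ^ 2))

@[fun_prop]
lemma measurable_gaussWeight (m : ℕ) (b : ℝ) : Measurable (gaussWeight m b) := by
  unfold gaussWeight; fun_prop

lemma lintegral_gaussWeight (m : ℕ) {b : ℝ} (hb : 0 < b) :
    ∫⁻ w, gaussWeight m b w = ENNReal.ofReal ((π / b) ^ (m / 2 : ℝ)) := by
  have h := GaussianFourier.integral_rexp_neg_mul_sq_norm (V := EuclideanSpace ℝ (Fin m)) hb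
  rw [finrank_euclideanSpace_fin] at h
  rw [← h, ofReal_integral_eq_lintegral_ofReal]
  · rfl
  · by_contra hn
    rw [integral_undef hn] at h
    have : 0 < (π / b) ^ (m / 2 : ℝ) := by positivity
    linarith
  · exact ae_of_all _ fun w => (exp_pos _).le

lemma lintegral_gaussWeight_le_two_mul_ball {m : ℕ} (hm : 1 ≤ m) :
    ∫⁻ w, gaussWeight m (256 * m) w
      ≤ 2 * ∫⁻ w in Metric.closedBall 0 (1 / 8), gaussWeight m (256 * m) w := by
  have hm' : (1 : ℝ) ≤ m := by exact_mod_cast hm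
  set B : Set (EuclideanSpace ℝ (Fin m)) := Metric.closedBall 0 (1 / 8)
  have hB : MeasurableSet B := Metric.isClosed_closedBall.measurableSet
  set Z := ∫⁻ w, gaussWeight m (256 * m) w with hZ
  have hZtop : Z ≠ ⊤ := by
    rw [hZ, lintegral_gaussWeight m (by positivity)]; exact ENNReal.ofReal_ne_top
  have hsplit :
      (∫⁻ w in B, gaussWeight m (256 * m) w) + (∫⁻ w in Bᶜ, gaussWeight m (256 * m) w) = Z :=
    lintegral_add_compl _ hB
  have hout : ∫⁻ w in Bᶜ, gaussWeight m (256 * m) w ≤ ENNReal.ofReal (1 / 2) * Z := by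
    calc ∫⁻ w in Bᶜ, gaussWeight m (256 * m) w
        ≤ ∫⁻ w in Bᶜ, ENNReal.ofReal (exp (-(2 * m))) * gaussWeight m (128 * m) w := by
          refine setLIntegral_mono (by fun_prop) fun w hw => ?_
          have hw' : 1 / 8 < ‖w‖ := by simpa [B] using hw
          rw [gaussWeight, gaussWeight, ← ENNReal.ofReal_mul (exp_pos _).le, ← Real.exp_add]
          apply ENNReal.ofReal_le_ofReal
          apply Real.exp_le_exp.2
          have : 1 / 64 ≤ ‖w‖ ^ 2 := by nlinarith
          nlinarith
      _ ≤ ∫⁻ w, ENNReal.ofReal (exp (-(2 * m))) * gaussWeight m (128 * m) w :=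
          setLIntegral_le_lintegral _ _
      _ = ENNReal.ofReal (exp (-(2 * m)) * (π / (128 * m)) ^ (m / 2 : ℝ)) := by
          rw [lintegral_const_mul _ (by fun_prop), lintegral_gaussWeight m (by positivity),
            ENNReal.ofReal_mul (exp_pos _).le]
      _ ≤ ENNReal.ofReal (1 / 2 * (π / (256 * m)) ^ (m / 2 : ℝ)) := by
          apply ENNReal.ofReal_le_ofReal
          have h1 : π / (128 * m) = 2 * (π / (256 * m)) := by field_simp; norm_num
          rw [h1, Real.mul_rpow (by norm_num) (by positivity), ← mul_assoc]
          gcongr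
          have h2 : (2 : ℝ) ^ (m / 2 : ℝ) ≤ exp m := by
            rw [Real.rpow_def_of_pos two_pos]
            apply Real.exp_le_exp.2
            nlinarith [Real.log_two_lt_d9]
          calc exp (-(2 * m)) * (2 : ℝ) ^ (m / 2 : ℝ) ≤ exp (-(2 * m)) * exp m := by gcongr
            _ = (exp m)⁻¹ := by rw [← Real.exp_add, ← Real.exp_neg]; ring_nf
            _ ≤ 1 / 2 := by
              rw [one_div]
              gcongr
              linarith [Real.add_one_le_exp (m : ℝ)]
      _ = ENNReal.ofReal (1 / 2) * Z := by
          rw [ENNReal.ofReal_mul (by norm_num), hZ, lintegral_gaussWeight m (by positivity)]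
  have h2 : Z + Z ≤ 2 * (∫⁻ w in B, gaussWeight m (256 * m) w) + Z := by
    calc Z + Z = 2 * Z := (two_mul _).symm
      _ ≤ 2 * ((∫⁻ w in B, gaussWeight m (256 * m) w) + ENNReal.ofReal (1 / 2) * Z) := by
          conv_lhs => rw [← hsplit]
          gcongr
      _ = 2 * (∫⁻ w in B, gaussWeight m (256 * m) w) + Z := by
          rw [mul_add, ← mul_assoc 2 (ENNReal.ofReal (1 / 2)) Z, one_div,
            ENNReal.ofReal_inv_of_pos two_pos, ENNReal.ofReal_ofNat,
            ENNReal.mul_inv_cancel two_ne_zero ENNReal.ofNat_ne_top, one_mul]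
  exact (ENNReal.add_le_add_iff_right hZtop).1 h2

/-- Lower bound for the Laplace transform of a truncated Gaussian weight. -/
lemma exp_mul_lintegral_gaussWeight_le {m : ℕ} (hm : 1 ≤ m) {δ : ℝ} (hδ : 0 ≤ δ)
    (hδ' : δ ≤ 1 / 8) (z : EuclideanSpace ℝ (Fin m)) :
    ENNReal.ofReal (exp (δ * ‖z‖ - 256 * m * δ ^ 2)) * ∫⁻ w, gaussWeight m (256 * m) w
      ≤ 2 * ∫⁻ w in Metric.closedBall 0 (1 / 4),
          ENNReal.ofReal (exp (inner ℝ w z)) * gaussWeight m (256 * m) w := by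
  have hm' : (1 : ℝ) ≤ m := by exact_mod_cast hm
  obtain ⟨v, hv, hvz⟩ : ∃ v : EuclideanSpace ℝ (Fin m), ‖v‖ ≤ δ ∧ inner ℝ v z = δ * ‖z‖ := by
    refine ⟨(δ / ‖z‖) • z, ?_, ?_⟩
    · rw [norm_smul, Real.norm_of_nonneg (by positivity)]
      by_cases h : ‖z‖ = 0
      · simpa [h] using hδ
      · rw [div_mul_cancel₀ _ h]
    · rw [real_inner_smul_left, real_inner_self_eq_norm_sq]
      by_cases h : ‖z‖ = 0
      · simp [h]
      · field_simp
  set c := ENNReal.ofReal (exp (δ * ‖z‖ - 256 * m * δ ^ 2)) with hc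
  set B : Set (EuclideanSpace ℝ (Fin m)) := Metric.closedBall 0 (1 / 8) with hBdef
  set Big : Set (EuclideanSpace ℝ (Fin m)) := Metric.closedBall 0 (1 / 4) with hBallDef
  have hB : MeasurableSet B := Metric.isClosed_closedBall.measurableSet
  have hBig : MeasurableSet Big := Metric.isClosed_closedBall.measurableSet
  set f : EuclideanSpace ℝ (Fin m) → ENNReal := fun w =>
    ENNReal.ofReal (exp (inner ℝ w z)) * gaussWeight m (256 * m) w with hf
  set g : EuclideanSpace ℝ (Fin m) → ENNReal := B.indicator (gaussWeight m (256 * m)) with hg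
  have hgm : Measurable g := (measurable_gaussWeight _ _).indicator hB
  have heven : ∀ w, g (-w) = g w := by
    intro w
    simp [hg, Set.indicator, B, gaussWeight]
  have hshift : ∀ w, c * (g w * ENNReal.ofReal (exp (inner ℝ w (z - (512 * m : ℝ) • v))))
      ≤ Big.indicator f (w + v) := by
    intro w
    by_cases hw : w ∈ B
    · have hw1 : ‖w‖ ≤ 1 / 8 := by simpa [B] using hw
      have hw2 : w + v ∈ Big := by
        simp only [Big, Metric.mem_closedBall, dist_zero_right]
        linarith [norm_add_le w v]
      rw [Set.indicator_of_mem hw2, hg, Set.indicator_of_mem hw, hc, hf]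
      simp only [gaussWeight]
      rw [← ENNReal.ofReal_mul (exp_pos _).le, ← ENNReal.ofReal_mul (exp_pos _).le,
        ← ENNReal.ofReal_mul (exp_pos _).le, ← Real.exp_add, ← Real.exp_add, ← Real.exp_add]
      apply ENNReal.ofReal_le_ofReal
      apply Real.exp_le_exp.2
      rw [norm_add_sq_real, inner_add_left, hvz, inner_sub_right, real_inner_smul_right]
      have : ‖v‖ ^ 2 ≤ δ ^ 2 := by gcongr
      nlinarith
    · simp [hg, Set.indicator_of_notMem hw]
  calc c * ∫⁻ w, gaussWeight m (256 * m) w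
      ≤ c * (2 * ∫⁻ w, g w) := by
        gcongr
        rw [hg, lintegral_indicator hB]
        exact lintegral_gaussWeight_le_two_mul_ball hm
    _ ≤ c * (2 * ∫⁻ w, g w * ENNReal.ofReal (exp (inner ℝ w (z - (512 * m : ℝ) • v)))) := by
        gcongr c * (2 * ?_)
        exact lintegral_even_le_lintegral_mul_exp_inner hgm heven _
    _ = 2 * ∫⁻ w, c * (g w * ENNReal.ofReal (exp (inner ℝ w (z - (512 * m : ℝ) • v)))) := by
        rw [lintegral_const_mul _ (by fun_prop)]
        ring
    _ ≤ 2 * ∫⁻ w, Big.indicator f (w + v) := by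
        gcongr with w
        exact hshift w
    _ = 2 * ∫⁻ w in Big, f w := by
        rw [lintegral_add_right_eq_self (Big.indicator f) v, lintegral_indicator hBig]

/-- Norm concentration from a bound on the Laplace transform on a ball. -/
lemma measure_le_norm_of_laplace_bound {Ω : Type*} [MeasurableSpace Ω] {μ : Measure Ω} [SFinite μ]
    {m : ℕ} (hm : 1 ≤ m) {X : Ω → EuclideanSpace ℝ (Fin m)} (hX : Measurable X) {C : ENNReal}
    (hC : ∀ w : EuclideanSpace ℝ (Fin m), ‖w‖ ≤ 1 / 4 →
      ∫⁻ x, ENNReal.ofReal (exp (inner ℝ w (X x))) ∂μ ≤ C)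
    {δ : ℝ} (hδ : 0 ≤ δ) (hδ' : δ ≤ 1 / 8) (t : ℝ) :
    ENNReal.ofReal (exp (δ * t - 256 * m * δ ^ 2)) * μ {x | t ≤ ‖X x‖} ≤ 2 * C := by
  have hm' : (1 : ℝ) ≤ m := by exact_mod_cast hm
  set Z := ∫⁻ w, gaussWeight m (256 * m) w with hZ
  have hZval : Z = ENNReal.ofReal ((π / (256 * m)) ^ (m / 2 : ℝ)) :=
    lintegral_gaussWeight m (by positivity)
  have hZtop : Z ≠ ⊤ := by rw [hZval]; exact ENNReal.ofReal_ne_top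
  have hZ0 : Z ≠ 0 := by
    rw [hZval]
    exact (ENNReal.ofReal_pos.2 (by positivity)).ne'
  set c := ENNReal.ofReal (exp (δ * t - 256 * m * δ ^ 2)) with hc
  have hA : MeasurableSet {x | t ≤ ‖X x‖} := measurableSet_le measurable_const hX.norm
  set Big : Set (EuclideanSpace ℝ (Fin m)) := Metric.closedBall 0 (1 / 4) with hBallDef
  have hBig : MeasurableSet Big := Metric.isClosed_closedBall.measurableSet
  have hfm : Measurable (Function.uncurry fun (x : Ω) (w : EuclideanSpace ℝ (Fin m)) =>
      ENNReal.ofReal (exp (inner ℝ w (X x))) * gaussWeight m (256 * m) w) := by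
    have : Measurable fun p : Ω × EuclideanSpace ℝ (Fin m) => gaussWeight m (256 * m) p.2 :=
      (measurable_gaussWeight _ _).comp measurable_snd
    unfold Function.uncurry
    fun_prop
  refine (ENNReal.mul_le_mul_iff_left hZ0 hZtop).1 ?_
  calc c * μ {x | t ≤ ‖X x‖} * Z = ∫⁻ _ in {x | t ≤ ‖X x‖}, c * Z ∂μ := by
        rw [setLIntegral_const]; ring
    _ ≤ ∫⁻ x in {x | t ≤ ‖X x‖}, 2 * (∫⁻ w in Big,
          ENNReal.ofReal (exp (inner ℝ w (X x))) * gaussWeight m (256 * m) w) ∂μ := by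
        refine setLIntegral_mono' hA fun x hx => ?_
        refine le_trans ?_ (exp_mul_lintegral_gaussWeight_le hm hδ hδ' (X x))
        rw [hc]
        gcongr
        exact hx
    _ ≤ ∫⁻ x, 2 * (∫⁻ w in Big,
          ENNReal.ofReal (exp (inner ℝ w (X x))) * gaussWeight m (256 * m) w) ∂μ :=
        setLIntegral_le_lintegral _ _
    _ = 2 * ∫⁻ w in Big, ∫⁻ x,
          ENNReal.ofReal (exp (inner ℝ w (X x))) * gaussWeight m (256 * m) w ∂μ := by
        rw [lintegral_const_mul _ hfm.lintegral_prod_right,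
          lintegral_lintegral_swap hfm.aemeasurable]
    _ ≤ 2 * ∫⁻ w in Big, C * gaussWeight m (256 * m) w := by
        gcongr 2 * ?_
        refine setLIntegral_mono' hBig fun w hw => ?_
        rw [lintegral_mul_const _ (by fun_prop)]
        gcongr
        exact hC w (by simpa [Big] using hw)
    _ ≤ 2 * ∫⁻ w, C * gaussWeight m (256 * m) w := by
        gcongr
        exact Measure.restrict_le_self
    _ = 2 * C * Z := by
        rw [lintegral_const_mul _ (by fun_prop), mul_assoc]

lemma sq_le_exp_add_exp_neg (y : ℝ) : y ^ 2 ≤ 16 * (exp (y / 4) + exp (-(y / 4)) - 2) := by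
  have h : ∀ u : ℝ, 0 ≤ u → 16 * u ^ 2 ≤ 16 * (exp u + exp (-u) - 2) := by
    intro u hu
    have h1 := Real.self_le_sinh_iff.2 (by linarith : 0 ≤ u / 2)
    have h2 : exp u + exp (-u) - 2 = 4 * Real.sinh (u / 2) ^ 2 := by
      rw [Real.sinh_eq]
      have e1 : exp u = exp (u / 2) ^ 2 := by rw [← Real.exp_nat_mul]; congr 1; push_cast; ring
      have e2 : exp (-u) = exp (-(u / 2)) ^ 2 := by
        rw [← Real.exp_nat_mul]; congr 1; push_cast; ring
      have e3 : exp (u / 2) * exp (-(u / 2)) = 1 := by rw [← Real.exp_add]; simp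
      rw [e1, e2]
      linear_combination 2 * e3
    rw [h2]
    nlinarith
  rcases le_total 0 y with hy | hy
  · linarith [h (y / 4) (by linarith)]
  · have := h (-(y / 4)) (by linarith)
    rw [neg_neg] at this
    linarith

lemma exp_one_eighth_le : exp (1 / 8) ≤ 8 / 7 := by
  have h := Real.one_sub_le_exp_neg (1 / 8)
  have h2 : exp (1 / 8) * exp (-(1 / 8)) = 1 := by rw [← Real.exp_add]; simp
  nlinarith [exp_pos (1 / 8)]

instance (n : ℕ) : IsProbabilityMeasure (gaussianPi n) := by
  unfold gaussianPi; infer_instance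

@[fun_prop]
lemma continuous_offDiagForm {n : ℕ} (M : Matrix (Fin n) (Fin n) ℝ) :
    Continuous fun x : Fin n → ℝ => offDiagForm x M := by
  unfold offDiagForm
  refine continuous_finsetSum _ fun a _ => continuous_finsetSum _ fun b _ => ?_
  split_ifs <;> fun_prop

/-- Second-moment (Markov) bound for the sum of squares of the forms. -/
lemma mul_measure_sum_sq_offDiagForm_le {n m : ℕ} {M : Fin m → Matrix (Fin n) (Fin n) ℝ}
    (hdiag : ∀ i a, M i a a = 0)
    (hunit : ∀ i, ∑ a : Fin n, ∑ b : Fin n, M i a b * M i a b = 1) (r : ℝ) :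
    r * (gaussianPi n {x : Fin n → ℝ | r ≤ ∑ i, (offDiagForm x (M i)) ^ 2}).toReal ≤ 5 * m := by
  have hscale : ∀ (s : ℝ) x i, offDiagForm x (s • M i) = s * offDiagForm x (M i) := by
    intro s x i
    simp only [offDiagForm, mul_sum]
    refine sum_congr rfl fun a _ => sum_congr rfl fun b _ => ?_
    split_ifs <;> simp
    ring
  have hmgf : ∀ s : ℝ, s ^ 2 = 1 / 16 → ∀ i,
      Integrable (fun x => exp (s * offDiagForm x (M i))) (gaussianPi n) ∧
      ∫ x, exp (s * offDiagForm x (M i)) ∂(gaussianPi n) ≤ 8 / 7 := by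
    intro s hs i
    have h := exp_offDiagForm_gaussianPi (M := s • M i) (by simp [hdiag]) (le_of_eq (by
      simp only [Matrix.smul_apply, smul_eq_mul, mul_pow, hs, ← mul_sum]
      simp only [pow_two, hunit, mul_one]))
    simp only [hscale] at h
    exact ⟨h.1, h.2.trans exp_one_eighth_le⟩
  let g : (Fin n → ℝ) → ℝ := fun x => ∑ i, 16 * (exp (1 / 4 * offDiagForm x (M i))
    + exp (-1 / 4 * offDiagForm x (M i)) - 2)
  have hle : ∀ x, ∑ i, (offDiagForm x (M i)) ^ 2 ≤ g x := by
    intro x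
    refine sum_le_sum fun i _ => (sq_le_exp_add_exp_neg _).trans (le_of_eq ?_)
    ring_nf
  have hi : ∀ i, Integrable (fun x => 16 * (exp (1 / 4 * offDiagForm x (M i))
      + exp (-1 / 4 * offDiagForm x (M i)) - 2)) (gaussianPi n) := fun i =>
    (((hmgf _ (by norm_num) i).1.add (hmgf _ (by norm_num) i).1).sub
      (integrable_const _)).const_mul _
  have hint : ∫ x, g x ∂(gaussianPi n) ≤ 5 * m := by
    rw [integral_finsetSum _ fun i _ => hi i]
    calc _ ≤ ∑ i : Fin m, (5 : ℝ) := by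
          refine sum_le_sum fun i _ => ?_
          have h1 := hmgf (1 / 4) (by norm_num) i
          have h2 := hmgf (-1 / 4) (by norm_num) i
          rw [integral_const_mul, integral_sub (h1.1.fun_add h2.1) (integrable_const _),
            integral_add h1.1 h2.1]
          simp only [integral_const, probReal_univ, smul_eq_mul]
          linarith [h1.2, h2.2]
      _ = 5 * m := by simp [mul_comm]
  have hg0 : ∀ x, 0 ≤ g x := fun x => (sum_nonneg fun i _ => sq_nonneg _).trans (hle x)
  rcases le_or_gt r 0 with hr | hr
  · exact (mul_nonpos_of_nonpos_of_nonneg hr ENNReal.toReal_nonneg).trans (by positivity)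
  have hmarkov := mul_meas_ge_le_integral_of_nonneg (μ := gaussianPi n) (ae_of_all _ hg0)
    (integrable_finsetSum _ fun i _ => hi i) r
  refine le_trans ?_ (hmarkov.trans hint)
  gcongr
  exact measureReal_mono fun x (hx : r ≤ _) => hx.trans (hle x)

lemma measure_sum_sq_offDiagForm_le {n m : ℕ} (hm : 1 ≤ m)
    {M : Fin m → Matrix (Fin n) (Fin n) ℝ}
    (hdiag : ∀ i a, M i a a = 0)
    (hunit : ∀ i, ∑ a : Fin n, ∑ b : Fin n, M i a b * M i a b = 1)
    (horth : ∀ i j, i ≠ j → ∑ a : Fin n, ∑ b : Fin n, M i a b * M j a b = 0)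
    {r : ℝ} (hr : 0 ≤ r) :
    (gaussianPi n {x : Fin n → ℝ | r ≤ ∑ i, (offDiagForm x (M i)) ^ 2}).toReal
      ≤ 16 / 7 * exp (-(r / (1024 * (m + √r)))) := by
  have hm' : (1 : ℝ) ≤ m := by exact_mod_cast hm
  set t := √r with ht
  have ht0 : 0 ≤ t := Real.sqrt_nonneg r
  have hrt : r = t ^ 2 := (Real.sq_sqrt hr).symm
  let X : (Fin n → ℝ) → EuclideanSpace ℝ (Fin m) := fun x =>
    WithLp.toLp 2 fun i => offDiagForm x (M i)
  have hX : Measurable X := by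
    have : Measurable fun (x : Fin n → ℝ) (i : Fin m) => offDiagForm x (M i) :=
      measurable_pi_iff.2 fun i => (continuous_offDiagForm (M i)).measurable
    exact (WithLp.measurable_toLp 2 _).comp this
  have hset : {x : Fin n → ℝ | r ≤ ∑ i, (offDiagForm x (M i)) ^ 2} = {x | t ≤ ‖X x‖} := by
    ext x
    simp only [Set.mem_ofPred_eq, X, EuclideanSpace.norm_eq, Real.norm_eq_abs, sq_abs, ht]
    rw [Real.sqrt_le_sqrt_iff (by positivity)]
  have hC : ∀ w : EuclideanSpace ℝ (Fin m), ‖w‖ ≤ 1 / 4 →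
      ∫⁻ x, ENNReal.ofReal (exp (inner ℝ w (X x))) ∂(gaussianPi n) ≤ ENNReal.ofReal (8 / 7) := by
    intro w hw
    have hw2 : ∑ i, w i ^ 2 ≤ 1 / 16 := by
      rw [← EuclideanSpace.real_norm_sq_eq]
      nlinarith [norm_nonneg w]
    have h := exp_sum_mul_offDiagForm_gaussianPi hdiag hunit horth hw2
    have hin : ∀ x, inner ℝ w (X x) = ∑ i, w i * offDiagForm x (M i) := by
      intro x
      simp [PiLp.inner_apply, X, mul_comm]
    simp only [hin]
    rw [← ofReal_integral_eq_lintegral_ofReal h.1 (ae_of_all _ fun x => (exp_pos _).le)]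
    exact ENNReal.ofReal_le_ofReal (h.2.trans exp_one_eighth_le)
  set δ := t / (512 * (m + t)) with hδ
  have hpos : 0 < m + t := by linarith
  have hδ0 : 0 ≤ δ := by positivity
  have hδ1 : δ ≤ 1 / 8 := by
    rw [hδ, div_le_div_iff₀ (by positivity) (by norm_num)]
    linarith
  have h := measure_le_norm_of_laplace_bound hm hX hC hδ0 hδ1 t
  rw [← hset] at h
  have h2 := ENNReal.toReal_mono (by finiteness) h
  rw [ENNReal.toReal_mul, ENNReal.toReal_mul, ENNReal.toReal_ofReal (exp_pos _).le,
    ENNReal.toReal_ofReal (by norm_num), ENNReal.toReal_ofNat] at h2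
  have hexp : r / (1024 * (m + t)) ≤ δ * t - 256 * m * δ ^ 2 := by
    have : δ * t - 256 * m * δ ^ 2 - r / (1024 * (m + t)) = t ^ 3 / (1024 * (m + t) ^ 2) := by
      rw [hδ, hrt]
      field_simp
      ring
    have h0 : 0 ≤ t ^ 3 / (1024 * (m + t) ^ 2) := by positivity
    linarith
  rw [Real.exp_neg, ← div_eq_mul_inv, le_div_iff₀ (exp_pos _), mul_comm]
  refine le_trans ?_ (h2.trans (by norm_num))
  gcongr

/-- **Concentration for sums of squares of orthonormal quadratic forms**
(a special case of the Hanson–Wright inequality of Adamczak–Latała–Meller).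
Let `M₁, …, M_m` be `n×n` real matrices, each with zero diagonal, orthonormal
in the entrywise inner product. Then for every `r ≥ 98m`,
`γ_n({x : ∑ᵢ ⟨x⊗̇x, Mᵢ⟩² ≥ r}) ≤ exp(−r/(56448·(m+√r)))`. -/
theorem quadratic_forms_concentration (n m : ℕ) (hn : 1 ≤ n) (hm : 1 ≤ m)
    (M : Fin m → Matrix (Fin n) (Fin n) ℝ)
    (hdiag : ∀ i a, M i a a = 0)
    (hunit : ∀ i, ∑ a : Fin n, ∑ b : Fin n, M i a b * M i a b = 1)
    (horth : ∀ i j, i ≠ j → ∑ a : Fin n, ∑ b : Fin n, M i a b * M j a b = 0)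
    (r : ℝ) (hr : 98 * m ≤ r) :
    (gaussianPi n {x : Fin n → ℝ | r ≤ ∑ i, (offDiagForm x (M i)) ^ 2}).toReal
      ≤ Real.exp (-(r / (56448 * (m + Real.sqrt r)))) := by
  have hm' : (1 : ℝ) ≤ m := by exact_mod_cast hm
  have hr0 : 0 < r := by linarith
  set P := (gaussianPi n {x : Fin n → ℝ | r ≤ ∑ i, (offDiagForm x (M i)) ^ 2}).toReal
  have hpos : 0 < m + √r := by positivity
  set X := r / (m + √r) with hX
  have h1 : r / (56448 * (m + √r)) = X / 56448 := by rw [hX]; field_simp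
  have h2 : r / (1024 * (m + √r)) = X / 1024 := by rw [hX]; field_simp
  rw [h1]
  rcases le_total X 2000 with hle | hge
  · have hmarkov : r * P ≤ 5 * m := mul_measure_sum_sq_offDiagForm_le hdiag hunit r
    have hP : P ≤ 5 / 98 := by
      by_contra! hcon
      nlinarith
    linarith [Real.add_one_le_exp (-(X / 56448))]
  · have htail : P ≤ 16 / 7 * exp (-(r / (1024 * (m + √r)))) :=
      measure_sum_sq_offDiagForm_le hm hdiag hunit horth hr0.le
    rw [h2] at htail
    have hsplit : exp (-(X / 56448)) = exp (X / 1024 - X / 56448) * exp (-(X / 1024)) := by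
      rw [← Real.exp_add]; ring_nf
    rw [hsplit]
    refine htail.trans ?_
    gcongr
    linarith [Real.add_one_le_exp (X / 1024 - X / 56448)]
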